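/- arXiv:1801.00231 — 3 statements merged into one kernel-verified Lean document; each statement's English description precedes it below -/
import Mathlib

section
/- With φ_j the orthonormal Legendre system on [t,T], define C_{j_2 j_1} = ∫_t^T φ_{j_2}(t_2) (∫_t^{t_2} φ_{j_1}(t_1) dt_1) dt_2. Then C_{0,0} = (T−t)/2; for every i ≥ 1, C_{i, i−1} = (T−t)/(2√(4i²−1)) and C_{i−1, i} = −(T−t)/(2√(4i²−1)); and C_{j_2 j_1} = 0 for all other pairs (j_1, j_2) (in particular whenever |j_1 − j_2| ≥ 2 and whenever j_1 = j_2 ≥ 1). -/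
open MeasureTheory intervalIntegral

/-- The Legendre polynomial `P_j` via the Rodrigues formula. -/
noncomputable def legendreP (j : ℕ) (x : ℝ) : ℝ :=
  (1 / (2 ^ j * (j.factorial : ℝ))) * iteratedDeriv j (fun y : ℝ => (y ^ 2 - 1) ^ j) x

/-- The orthonormal Legendre system `φ_j` on `[t, T]`. -/
noncomputable def legendreFun (t T : ℝ) (j : ℕ) (x : ℝ) : ℝ :=
  Real.sqrt ((2 * j + 1) / (T - t)) * legendreP j ((x - (T + t) / 2) * (2 / (T - t)))

/-- The double Fourier–Legendre coefficient
`C_{j₂ j₁} = ∫_t^T φ_{j₂}(t₂) (∫_t^{t₂} φ_{j₁}(t₁) dt₁) dt₂` of the indicator of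
`{t₁ < t₂}` on `[t,T]²`. -/
noncomputable def doubleCoeff (t T : ℝ) (j₂ j₁ : ℕ) : ℝ :=
  ∫ t₂ in t..T, legendreFun t T j₂ t₂ * ∫ t₁ in t..t₂, legendreFun t T j₁ t₁

open Polynomial in
/-- The polynomial `(d/dx)^k (x² - 1)^n`. -/
noncomputable def rodrigues (n k : ℕ) : ℝ[X] := derivative^[k] ((X ^ 2 - 1) ^ n)

open Polynomial in
/-- The antiderivative of `rodrigues n n` that vanishes at `-1`. -/
noncomputable def rodriguesPrimitive : ℕ → ℝ[X]
  | 0 => X + 1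
  | n + 1 => rodrigues (n + 1) n

/-- The unnormalized double coefficient on `[-1, 1]`. -/
noncomputable def rodriguesPairing (a b : ℕ) : ℝ :=
  ∫ x in (-1 : ℝ)..1, (rodrigues a a).eval x * (rodriguesPrimitive b).eval x

theorem Polynomial.integral_eval_derivative (p : Polynomial ℝ) (a b : ℝ) :
    ∫ x in a..b, p.derivative.eval x = p.eval b - p.eval a :=
  integral_eq_sub_of_hasDerivAt (fun x _ => p.hasDerivAt x)
    (p.derivative.continuous.intervalIntegrable a b)

theorem Polynomial.integral_derivative_mul (p q : Polynomial ℝ) (a b : ℝ) :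
    ∫ x in a..b, p.derivative.eval x * q.eval x =
      p.eval b * q.eval b - p.eval a * q.eval a -
        ∫ x in a..b, p.eval x * q.derivative.eval x := by
  have hsum := integral_eq_sub_of_hasDerivAt
    (fun x _ => (p.hasDerivAt x).mul (q.hasDerivAt x))
    (Continuous.intervalIntegrable (by fun_prop) a b)
  rw [intervalIntegral.integral_add (Continuous.intervalIntegrable (by fun_prop) _ _)
    (Continuous.intervalIntegrable (by fun_prop) _ _)] at hsum
  exact eq_sub_of_add_eq hsum

theorem derivative_rodrigues (n k : ℕ) :
    (rodrigues n k).derivative = rodrigues n (k + 1) :=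
  (Function.iterate_succ_apply' _ _ _).symm

theorem iteratedDeriv_sq_sub_one_pow (n k : ℕ) :
    iteratedDeriv k (fun y : ℝ => (y ^ 2 - 1) ^ n) = fun x => (rodrigues n k).eval x := by
  induction k with
  | zero => ext x; simp [rodrigues]
  | succ k ih =>
    ext x
    rw [iteratedDeriv_succ, ih, Polynomial.deriv, derivative_rodrigues]

theorem eval_rodrigues_eq_zero {n k : ℕ} (hk : k < n) {x : ℝ} (hx : x ^ 2 = 1) :
    (rodrigues n k).eval x = 0 := by
  obtain ⟨q, hq⟩ := Polynomial.pow_sub_dvd_iterate_derivative_pow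
    (Polynomial.X ^ 2 - 1 : Polynomial ℝ) n k
  rw [rodrigues, hq]
  simp [hx, Nat.sub_ne_zero_of_lt hk]

theorem derivative_rodriguesPrimitive (n : ℕ) :
    (rodriguesPrimitive n).derivative = rodrigues n n := by
  cases n with
  | zero => simp [rodriguesPrimitive, rodrigues]
  | succ n => exact derivative_rodrigues _ _

theorem eval_neg_one_rodriguesPrimitive (n : ℕ) : (rodriguesPrimitive n).eval (-1) = 0 := by
  cases n with
  | zero => simp [rodriguesPrimitive]
  | succ n => exact eval_rodrigues_eq_zero n.lt_succ_self (by norm_num)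

theorem eval_one_rodriguesPrimitive {n : ℕ} (hn : n ≠ 0) :
    (rodriguesPrimitive n).eval 1 = 0 := by
  cases n with
  | zero => exact absurd rfl hn
  | succ n => exact eval_rodrigues_eq_zero n.lt_succ_self (by norm_num)

theorem natDegree_sq_sub_one_pow (n : ℕ) :
    ((Polynomial.X ^ 2 - 1 : Polynomial ℝ) ^ n).natDegree = 2 * n := by
  rw [Polynomial.natDegree_pow, ← Polynomial.C_1, Polynomial.natDegree_X_pow_sub_C, mul_comm]

theorem rodrigues_two_mul (n : ℕ) :
    rodrigues n (2 * n) = Polynomial.C ((2 * n).factorial : ℝ) := by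
  have hmonic : ((Polynomial.X ^ 2 - 1 : Polynomial ℝ) ^ n).Monic :=
    (Polynomial.C_1 (R := ℝ) ▸ Polynomial.monic_X_pow_sub_C (1 : ℝ) two_ne_zero).pow n
  have hdeg := Polynomial.natDegree_iterate_derivative
    ((Polynomial.X ^ 2 - 1 : Polynomial ℝ) ^ n) (2 * n)
  rw [natDegree_sq_sub_one_pow, Nat.sub_self, Nat.le_zero] at hdeg
  have hlead := hmonic.coeff_natDegree
  rw [natDegree_sq_sub_one_pow] at hlead
  rw [rodrigues, Polynomial.eq_C_of_natDegree_eq_zero hdeg, Polynomial.coeff_iterate_derivative,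
    zero_add, hlead, Nat.descFactorial_self, nsmul_eq_mul, mul_one]

theorem iterate_derivative_rodriguesPrimitive (n : ℕ) :
    Polynomial.derivative^[n + 1] (rodriguesPrimitive n) =
      Polynomial.C ((2 * n).factorial : ℝ) := by
  rw [Function.iterate_succ_apply, derivative_rodriguesPrimitive, ← rodrigues_two_mul, rodrigues,
    rodrigues, ← Function.iterate_add_apply, two_mul]

theorem iterate_derivative_rodriguesPrimitive_eq_zero {m n : ℕ} (h : n + 1 < m) :
    Polynomial.derivative^[m] (rodriguesPrimitive n) = 0 := by
  obtain ⟨k, rfl⟩ := Nat.exists_eq_add_of_lt h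
  rw [show n + 1 + k + 1 = (k + 1) + (n + 1) by ring, Function.iterate_add_apply,
    iterate_derivative_rodriguesPrimitive, Polynomial.iterate_derivative_C k.succ_pos]

/-- Rodrigues' formula moves derivatives onto the other factor. -/
theorem integral_rodrigues_mul (n k : ℕ) (hk : k ≤ n) (p : Polynomial ℝ) :
    ∫ x in (-1 : ℝ)..1, (rodrigues n k).eval x * p.eval x =
      (-1) ^ k * ∫ x in (-1 : ℝ)..1,
        (x ^ 2 - 1) ^ n * (Polynomial.derivative^[k] p).eval x := by
  induction k generalizing p with
  | zero => simp [rodrigues]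
  | succ k ih =>
    rw [← derivative_rodrigues, Polynomial.integral_derivative_mul,
      eval_rodrigues_eq_zero hk (by norm_num), eval_rodrigues_eq_zero hk (by norm_num),
      ih (by lia), Function.iterate_succ_apply]
    ring

theorem integral_sq_sub_one_pow_succ (n : ℕ) :
    (2 * n + 3 : ℝ) * ∫ x in (-1 : ℝ)..1, (x ^ 2 - 1) ^ (n + 1) =
      -(2 * (n + 1)) * ∫ x in (-1 : ℝ)..1, (x ^ 2 - 1) ^ n := by
  have hzero : ∫ x in (-1 : ℝ)..1,
      ((2 * n + 3) * (x ^ 2 - 1) ^ (n + 1) + 2 * (n + 1) * (x ^ 2 - 1) ^ n) = 0 := by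
    have hderiv : ∀ x : ℝ, HasDerivAt (fun x : ℝ => x * (x ^ 2 - 1) ^ (n + 1))
        ((2 * n + 3) * (x ^ 2 - 1) ^ (n + 1) + 2 * (n + 1) * (x ^ 2 - 1) ^ n) x := by
      intro x
      refine ((hasDerivAt_id x).mul
        ((((hasDerivAt_id x).pow 2).sub_const 1).pow (n + 1))).congr_deriv ?_
      simp
      ring
    rw [integral_eq_sub_of_hasDerivAt (fun x _ => hderiv x)
      (Continuous.intervalIntegrable (by fun_prop) _ _)]
    simp
  rw [intervalIntegral.integral_add (Continuous.intervalIntegrable (by fun_prop) _ _)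
    (Continuous.intervalIntegrable (by fun_prop) _ _), intervalIntegral.integral_const_mul,
    intervalIntegral.integral_const_mul] at hzero
  linarith

theorem integral_sq_sub_one_pow (n : ℕ) :
    ∫ x in (-1 : ℝ)..1, (x ^ 2 - 1) ^ n =
      (-1) ^ n * 2 ^ (2 * n + 1) * (n.factorial : ℝ) ^ 2 / (2 * n + 1).factorial := by
  induction n with
  | zero => norm_num
  | succ n ih =>
    have hrec := integral_sq_sub_one_pow_succ n
    have hpos : (2 * n + 3 : ℝ) ≠ 0 := by positivity
    rw [ih] at hrec
    refine mul_left_cancel₀ hpos (hrec.trans ?_)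
    rw [show 2 * (n + 1) + 1 = (2 * n + 1) + 1 + 1 by ring, Nat.factorial_succ (2 * n + 1 + 1),
      Nat.factorial_succ (2 * n + 1), Nat.factorial_succ n]
    have := Nat.cast_ne_zero (R := ℝ).2 (Nat.factorial_ne_zero (2 * n + 1))
    push_cast
    field_simp
    ring

theorem rodriguesPairing_eq_zero {a b : ℕ} (h : b + 1 < a) : rodriguesPairing a b = 0 := by
  rw [rodriguesPairing, integral_rodrigues_mul a a le_rfl,
    iterate_derivative_rodriguesPrimitive_eq_zero h]
  simp

theorem rodriguesPairing_antisymm {a b : ℕ} (h : a ≠ 0 ∨ b ≠ 0) :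
    rodriguesPairing a b = -rodriguesPairing b a := by
  have hone : (rodriguesPrimitive a).eval 1 * (rodriguesPrimitive b).eval 1 = 0 := by
    rcases h with h | h <;> simp [eval_one_rodriguesPrimitive h]
  rw [rodriguesPairing, ← derivative_rodriguesPrimitive, Polynomial.integral_derivative_mul, hone,
    eval_neg_one_rodriguesPrimitive, derivative_rodriguesPrimitive, rodriguesPairing]
  simp [mul_comm]

theorem rodriguesPairing_zero_zero : rodriguesPairing 0 0 = 2 := by
  norm_num [rodriguesPairing, rodrigues, rodriguesPrimitive]

theorem rodriguesPairing_succ_self (n : ℕ) :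
    rodriguesPairing (n + 1) n =
      (2 * n).factorial * 2 ^ (2 * n + 3) * ((n + 1).factorial : ℝ) ^ 2 /
        (2 * n + 3).factorial := by
  rw [rodriguesPairing, integral_rodrigues_mul _ _ le_rfl, iterate_derivative_rodriguesPrimitive]
  simp only [Polynomial.eval_C]
  rw [intervalIntegral.integral_mul_const, integral_sq_sub_one_pow, show 2 * (n + 1) + 1 = 2 * n + 3 by ring]
  have hsign : ((-1 : ℝ) ^ (n + 1)) * (-1) ^ (n + 1) = 1 := by
    rw [← mul_pow]; norm_num
  linear_combination ((2 * n).factorial * 2 ^ (2 * n + 3) * ((n + 1).factorial : ℝ) ^ 2 /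
        (2 * n + 3).factorial) * hsign

theorem legendreFun_eq (t T : ℝ) (j : ℕ) (x : ℝ) :
    legendreFun t T j x = Real.sqrt ((2 * j + 1) / (T - t)) *
      (1 / (2 ^ j * (j.factorial : ℝ))) *
        (rodrigues j j).eval (2 / (T - t) * x - (T + t) / (T - t)) := by
  rw [legendreFun, legendreP, iteratedDeriv_sq_sub_one_pow, mul_assoc]
  congr 4
  ring

theorem integral_legendreFun {t T : ℝ} (h : t < T) (j : ℕ) (s : ℝ) :
    ∫ x in t..s, legendreFun t T j x = Real.sqrt ((2 * j + 1) / (T - t)) *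
      (1 / (2 ^ j * (j.factorial : ℝ))) * ((T - t) / 2) *
        (rodriguesPrimitive j).eval (2 / (T - t) * s - (T + t) / (T - t)) := by
  have hT : T - t ≠ 0 := (sub_pos.2 h).ne'
  have hlow : 2 / (T - t) * t - (T + t) / (T - t) = -1 := by field_simp; ring
  simp_rw [legendreFun_eq]
  rw [intervalIntegral.integral_const_mul, integral_comp_mul_sub (fun y => (rodrigues j j).eval y)
    (div_ne_zero two_ne_zero hT), ← derivative_rodriguesPrimitive,
    Polynomial.integral_eval_derivative, hlow, eval_neg_one_rodriguesPrimitive, sub_zero, inv_div,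
    smul_eq_mul]
  ring

theorem doubleCoeff_eq {t T : ℝ} (h : t < T) (a b : ℕ) :
    doubleCoeff t T a b =
      Real.sqrt ((2 * a + 1) * (2 * b + 1)) * (T - t) /
        (4 * (2 ^ a * (a.factorial : ℝ)) * (2 ^ b * (b.factorial : ℝ))) *
          rodriguesPairing a b := by
  have hpos : 0 < T - t := sub_pos.2 h
  have hT : T - t ≠ 0 := hpos.ne'
  have hlow : 2 / (T - t) * t - (T + t) / (T - t) = -1 := by field_simp; ring
  have hhigh : 2 / (T - t) * T - (T + t) / (T - t) = 1 := by field_simp; ring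
  have hsqrt : Real.sqrt ((2 * a + 1) / (T - t)) * Real.sqrt ((2 * b + 1) / (T - t)) =
      Real.sqrt ((2 * a + 1) * (2 * b + 1)) / (T - t) := by
    rw [← Real.sqrt_mul (by positivity), div_mul_div_comm, Real.sqrt_div (by positivity),
      Real.sqrt_mul_self hpos.le]
  have hfactor : ∀ x, legendreFun t T a x * ∫ y in t..x, legendreFun t T b y =
      Real.sqrt ((2 * a + 1) * (2 * b + 1)) / (T - t) * (1 / (2 ^ a * (a.factorial : ℝ))) *
        (1 / (2 ^ b * (b.factorial : ℝ))) * ((T - t) / 2) *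
        (fun y => (rodrigues a a).eval y * (rodriguesPrimitive b).eval y)
          (2 / (T - t) * x - (T + t) / (T - t)) := by
    intro x
    rw [integral_legendreFun h, legendreFun_eq, ← hsqrt]
    ring
  simp_rw [doubleCoeff, hfactor]
  rw [intervalIntegral.integral_const_mul, integral_comp_mul_sub
    (fun y => (rodrigues a a).eval y * (rodriguesPrimitive b).eval y)
    (div_ne_zero two_ne_zero hT), hlow, hhigh, inv_div, smul_eq_mul, ← rodriguesPairing]
  field_simp
  ring

theorem doubleCoeff_antisymm {t T : ℝ} (h : t < T) {a b : ℕ} (hab : a ≠ 0 ∨ b ≠ 0) :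
    doubleCoeff t T a b = -doubleCoeff t T b a := by
  rw [doubleCoeff_eq h, doubleCoeff_eq h, rodriguesPairing_antisymm hab,
    mul_comm (2 * (a : ℝ) + 1)]
  ring

theorem doubleCoeff_eq_zero_of_lt {t T : ℝ} (h : t < T) {a b : ℕ} (hab : b + 1 < a) :
    doubleCoeff t T a b = 0 := by
  rw [doubleCoeff_eq h, rodriguesPairing_eq_zero hab, mul_zero]

theorem doubleCoeff_succ_self {t T : ℝ} (h : t < T) (n : ℕ) :
    doubleCoeff t T (n + 1) n =
      (T - t) / (2 * Real.sqrt (4 * ((n + 1 : ℕ) : ℝ) ^ 2 - 1)) := by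
  have hprod : 4 * ((n + 1 : ℕ) : ℝ) ^ 2 - 1 = (2 * ((n + 1 : ℕ) : ℝ) + 1) * (2 * n + 1) := by
    push_cast; ring
  have hsq : Real.sqrt ((2 * ((n + 1 : ℕ) : ℝ) + 1) * (2 * n + 1)) ^ 2 =
      (2 * n + 3) * (2 * n + 1) := by
    rw [Real.sq_sqrt (by positivity)]; push_cast; ring
  have hpos : 0 < Real.sqrt ((2 * ((n + 1 : ℕ) : ℝ) + 1) * (2 * n + 1)) :=
    Real.sqrt_pos.2 (by positivity)
  rw [doubleCoeff_eq h, rodriguesPairing_succ_self, hprod]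
  generalize Real.sqrt ((2 * ((n + 1 : ℕ) : ℝ) + 1) * (2 * n + 1)) = r at hsq hpos ⊢
  rw [Nat.factorial_succ (2 * n + 2), Nat.factorial_succ (2 * n + 1), Nat.factorial_succ (2 * n),
    Nat.factorial_succ n]
  have := Nat.cast_ne_zero (R := ℝ).2 (Nat.factorial_ne_zero (2 * n))
  have := Nat.cast_ne_zero (R := ℝ).2 (Nat.factorial_ne_zero n)
  push_cast
  field_simp
  rw [hsq]
  ring

/-- Explicit values of the double Fourier–Legendre coefficients of `1_{{t₁ < t₂}}`. -/
theorem double_fourier_legendre_coeffs (t T : ℝ) (h : t < T) :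
    doubleCoeff t T 0 0 = (T - t) / 2 ∧
    (∀ i : ℕ, 1 ≤ i →
      doubleCoeff t T i (i - 1) = (T - t) / (2 * Real.sqrt (4 * (i : ℝ) ^ 2 - 1)) ∧
      doubleCoeff t T (i - 1) i = -((T - t) / (2 * Real.sqrt (4 * (i : ℝ) ^ 2 - 1)))) ∧
    ∀ j₁ j₂ : ℕ, j₂ ≠ j₁ + 1 → j₁ ≠ j₂ + 1 → ¬(j₁ = 0 ∧ j₂ = 0) →
      doubleCoeff t T j₂ j₁ = 0 := by
  refine ⟨?_, ?_, ?_⟩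
  · rw [doubleCoeff_eq h, rodriguesPairing_zero_zero]
    norm_num
    ring
  · intro i hi
    obtain ⟨n, rfl⟩ := Nat.exists_eq_add_of_le' hi
    rw [Nat.add_sub_cancel, doubleCoeff_antisymm h (Or.inr n.succ_ne_zero),
      doubleCoeff_succ_self h]
    exact ⟨rfl, rfl⟩
  · intro j₁ j₂ h₂ h₁ h₀
    have hne : j₂ ≠ 0 ∨ j₁ ≠ 0 := by lia
    rcases lt_trichotomy j₁ j₂ with hlt | rfl | hlt
    · exact doubleCoeff_eq_zero_of_lt h (by lia)
    · exact self_eq_neg.1 (doubleCoeff_antisymm h hne)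
    · rw [doubleCoeff_antisymm h hne, doubleCoeff_eq_zero_of_lt h (by lia), neg_zero]
end

section
/- The following identity of convergent number series holds: 2·∑_{i=2}^∞ 1/(4i²−1) + ∑_{i=1}^∞ 1/((2i−1)²(2i+3)²) + ∑_{i=0}^∞ ((i+2)² + (i+1)²)/((2i+1)(2i+5)(2i+3)²) = 5/9. -/
open Filter Topology in
/-- A summable series whose terms are differences of consecutive terms of a null sequence `g`
has sum `g 0`. -/
theorem tsum_eq_zero_term_of_telescoping {f g : ℕ → ℝ} (hf : Summable f)
    (hfg : ∀ i, f i = g i - g (i + 1)) (hg : Tendsto g atTop (𝓝 0)) :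
    ∑' i, f i = g 0 := by
  refine tendsto_nhds_unique hf.hasSum.tendsto_sum_nat ?_
  simp_rw [hfg, Finset.sum_range_sub']
  simpa using hg.const_sub (g 0)

/-- Comparison of a nonnegative real series with `∑ 1 / (i + 1) ^ 2`. -/
theorem summable_of_le_one_div_add_one_sq {f : ℕ → ℝ} (h_nonneg : ∀ i, 0 ≤ f i)
    (hle : ∀ i : ℕ, f i ≤ 1 / ((i : ℝ) + 1) ^ 2) : Summable f := by
  refine Summable.of_nonneg_of_le h_nonneg hle ?_
  have h := (summable_nat_add_iff 1).2 (Real.summable_one_div_nat_pow.2 one_lt_two)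
  simpa using h

open Filter Topology in
theorem tendsto_one_div_two_mul_add_atTop (c : ℝ) :
    Tendsto (fun i : ℕ => 1 / (2 * (i : ℝ) + c)) atTop (𝓝 0) := by
  simp_rw [one_div]
  exact tendsto_inv_atTop_zero.comp
    (tendsto_atTop_add_const_right _ c (tendsto_natCast_atTop_atTop.const_mul_atTop two_pos))

/-- The identity of convergent number series
`2·∑_{i=2}^∞ 1/(4i²−1) + ∑_{i=1}^∞ 1/((2i−1)²(2i+3)²)
 + ∑_{i=0}^∞ ((i+2)²+(i+1)²)/((2i+1)(2i+5)(2i+3)²) = 5/9`. -/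
theorem series_identity_five_ninths :
    2 * (∑' i : ℕ, (1 : ℝ) / (4 * ((i : ℝ) + 2) ^ 2 - 1)) +
      (∑' i : ℕ, (1 : ℝ) /
        ((2 * ((i : ℝ) + 1) - 1) ^ 2 * (2 * ((i : ℝ) + 1) + 3) ^ 2)) +
      (∑' i : ℕ, (((i : ℝ) + 2) ^ 2 + ((i : ℝ) + 1) ^ 2) /
        ((2 * (i : ℝ) + 1) * (2 * (i : ℝ) + 5) * (2 * (i : ℝ) + 3) ^ 2))
      = 5 / 9 := by
  have summable_a : Summable fun i : ℕ => (1 : ℝ) / (4 * ((i : ℝ) + 2) ^ 2 - 1) := by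
    refine summable_of_le_one_div_add_one_sq (fun i => ?_) (fun i => ?_)
    · have : (0 : ℝ) ≤ i := i.cast_nonneg
      exact div_nonneg zero_le_one (by nlinarith)
    · have : (0 : ℝ) ≤ i := i.cast_nonneg
      exact one_div_le_one_div_of_le (by positivity) (by nlinarith)
  have summable_b : Summable fun i : ℕ => (1 : ℝ) /
      ((2 * ((i : ℝ) + 1) - 1) ^ 2 * (2 * ((i : ℝ) + 1) + 3) ^ 2) := by
    refine summable_of_le_one_div_add_one_sq (fun i => by positivity) (fun i => ?_)
    have : (0 : ℝ) ≤ i := i.cast_nonneg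
    refine one_div_le_one_div_of_le (by positivity) ?_
    rw [← mul_pow]
    exact pow_le_pow_left₀ (by positivity) (by nlinarith) 2
  have summable_c : Summable fun i : ℕ => (((i : ℝ) + 2) ^ 2 + ((i : ℝ) + 1) ^ 2) /
      ((2 * (i : ℝ) + 1) * (2 * (i : ℝ) + 5) * (2 * (i : ℝ) + 3) ^ 2) := by
    refine summable_of_le_one_div_add_one_sq (fun i => by positivity) (fun i => ?_)
    rw [div_le_div_iff₀ (by positivity) (by positivity), ← sub_nonneg]
    ring_nf
    positivity
  rw [← tsum_mul_left, ← (summable_a.mul_left 2).tsum_add summable_b,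
    ← ((summable_a.mul_left 2).add summable_b).tsum_add summable_c,
    tsum_eq_zero_term_of_telescoping
      (g := fun i : ℕ => 1 / (2 * (i : ℝ) + 3) +
        ((1 / (2 * (i : ℝ) + 1)) ^ 2 - (1 / (2 * (i : ℝ) + 3)) ^ 2) / 16 +
        (1 / (2 * (i : ℝ) + 1) + 1 / (2 * (i : ℝ) + 3)) / 8)
      (((summable_a.mul_left 2).add summable_b).add summable_c)]
  · norm_num
  · intro i
    have h₁ : 4 * ((i : ℝ) + 2) ^ 2 - 1 = (2 * i + 3) * (2 * i + 5) := by ring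
    have h₂ : 2 * ((i : ℝ) + 1) - 1 = 2 * i + 1 := by ring
    have h₃ : 2 * ((i : ℝ) + 1) + 3 = 2 * i + 5 := by ring
    have h₄ : 2 * ((i : ℝ) + 1) + 1 = 2 * i + 3 := by ring
    push_cast
    rw [h₁, h₂, h₃, h₄]
    field_simp
    ring
  · have h₁ := tendsto_one_div_two_mul_add_atTop 1
    have h₃ := tendsto_one_div_two_mul_add_atTop 3
    simpa using (h₃.add (((h₁.pow 2).sub (h₃.pow 2)).div_const 16)).add
      ((h₁.add h₃).div_const 8)
end

section
/- The following identity of convergent number series holds: ∑_{i=0}^∞ 1/((2i+1)(2i+5)(2i+3)²) + 2·∑_{i=1}^∞ 1/((2i−1)²(2i+3)²) = 1/9. -/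
open Filter Topology in
/-- Both series combine termwise to a second difference of `1 / (8 (2 i + 1)²)`,
so that the sum telescopes. -/
theorem hasSum_legendre_combined :
    HasSum (fun i : ℕ => (1 : ℝ) /
        ((2 * (i : ℝ) + 1) * (2 * (i : ℝ) + 5) * (2 * (i : ℝ) + 3) ^ 2) +
      2 * ((1 : ℝ) / ((2 * ((i : ℝ) + 1) - 1) ^ 2 * (2 * ((i : ℝ) + 1) + 3) ^ 2)))
      (1 / 9) := by
  rw [hasSum_iff_tendsto_nat_of_nonneg (fun i => by positivity)]
  have partial_sum : ∀ n : ℕ, ∑ i ∈ Finset.range n, ((1 : ℝ) /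
        ((2 * (i : ℝ) + 1) * (2 * (i : ℝ) + 5) * (2 * (i : ℝ) + 3) ^ 2) +
      2 * ((1 : ℝ) / ((2 * ((i : ℝ) + 1) - 1) ^ 2 * (2 * ((i : ℝ) + 1) + 3) ^ 2))) =
      1 / 9 - 1 / 8 * (((2 * (n : ℝ) + 1)⁻¹) ^ 2 - ((2 * (n : ℝ) + 3)⁻¹) ^ 2) := by
    intro n
    induction n with
    | zero => norm_num
    | succ n ih =>
      rw [Finset.sum_range_succ, ih]
      push_cast
      have h1 : 2 * ((n : ℝ) + 1) - 1 = 2 * n + 1 := by ring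
      have h2 : 2 * ((n : ℝ) + 1) + 3 = 2 * n + 5 := by ring
      have h3 : 2 * ((n : ℝ) + 1) + 1 = 2 * n + 3 := by ring
      rw [h1, h2, h3]
      have ha : 2 * (n : ℝ) + 1 ≠ 0 := by positivity
      have hb : 2 * (n : ℝ) + 3 ≠ 0 := by positivity
      have hc : 2 * (n : ℝ) + 5 ≠ 0 := by positivity
      field_simp
      ring
  simp_rw [partial_sum]
  have inv_tendsto : ∀ c : ℝ, Tendsto (fun n : ℕ => (2 * (n : ℝ) + c)⁻¹) atTop (𝓝 0) := fun c =>
    tendsto_inv_atTop_zero.comp (tendsto_atTop_add_const_right _ c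
      (tendsto_natCast_atTop_atTop.const_mul_atTop two_pos))
  simpa using ((((inv_tendsto 1).pow 2).sub ((inv_tendsto 3).pow 2)).const_mul (1 / 8 : ℝ)).const_sub
    (1 / 9 : ℝ)

/-- The identity of convergent number series
`∑_{i=0}^∞ 1/((2i+1)(2i+5)(2i+3)²) + 2·∑_{i=1}^∞ 1/((2i−1)²(2i+3)²) = 1/9`. -/
theorem series_identity_one_ninth :
    (∑' i : ℕ, (1 : ℝ) /
        ((2 * (i : ℝ) + 1) * (2 * (i : ℝ) + 5) * (2 * (i : ℝ) + 3) ^ 2)) +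
      2 * (∑' i : ℕ, (1 : ℝ) /
        ((2 * ((i : ℝ) + 1) - 1) ^ 2 * (2 * ((i : ℝ) + 1) + 3) ^ 2))
      = 1 / 9 := by
  have nonneg_second : ∀ i : ℕ, (0 : ℝ) ≤
      1 / ((2 * ((i : ℝ) + 1) - 1) ^ 2 * (2 * ((i : ℝ) + 1) + 3) ^ 2) :=
    fun i => by positivity
  have nonneg_first : ∀ i : ℕ, (0 : ℝ) ≤
      1 / ((2 * (i : ℝ) + 1) * (2 * (i : ℝ) + 5) * (2 * (i : ℝ) + 3) ^ 2) :=
    fun i => by positivity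
  have summable_first := Summable.of_nonneg_of_le nonneg_first
    (fun i => le_add_of_nonneg_right (mul_nonneg zero_le_two (nonneg_second i)))
    hasSum_legendre_combined.summable
  have summable_second := Summable.of_nonneg_of_le
    (fun i => mul_nonneg zero_le_two (nonneg_second i))
    (fun i => le_add_of_nonneg_left (nonneg_first i)) hasSum_legendre_combined.summable
  rw [← tsum_mul_left, ← summable_first.tsum_add summable_second]
  exact hasSum_legendre_combined.tsum_eq
end
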